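/- Let (X, 𝓑, μ, T) be an m.t.d.s. (not necessarily ergodic) and 𝓤 a cover of X. Then h_μ^+(𝓤, T) = h_μ^−(𝓤, T). -/

import Mathlib

open MeasureTheory Filter Topology
open scoped Classical

variable {X : Type*} [MeasurableSpace X]

noncomputable def cJoin (U V : Finset (Set X)) : Finset (Set X) :=
  (U ×ˢ V).image fun p => p.1 ∩ p.2

noncomputable def preC (S : X → X) (U : Finset (Set X)) : Finset (Set X) :=
  U.image fun A => S ⁻¹' A

noncomputable def joinN (S : X → X) (U : Finset (Set X)) : ℕ → Finset (Set X)
  | 0 => {Set.univ}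
  | n + 1 => cJoin (joinN S U n) (preC (S^[n]) U)

def IsMCover (U : Finset (Set X)) : Prop :=
  (∀ A ∈ U, MeasurableSet A) ∧ ⋃₀ (U : Set (Set X)) = Set.univ

def IsMPartition (U : Finset (Set X)) : Prop :=
  IsMCover U ∧ ∀ A ∈ U, ∀ B ∈ U, A ≠ B → Disjoint A B

def Refines (α U : Finset (Set X)) : Prop := ∀ A ∈ α, ∃ B ∈ U, A ⊆ B

noncomputable def entPart (μ : Measure X) (α : Finset (Set X)) : ℝ :=
  ∑ A ∈ α, Real.negMulLog (μ A).toReal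

noncomputable def entCover (μ : Measure X) (U : Finset (Set X)) : ℝ :=
  sInf {h | ∃ α : Finset (Set X), IsMPartition α ∧ Refines α U ∧ h = entPart μ α}

noncomputable def hPart (μ : Measure X) (S : X → X) (α : Finset (Set X)) : ℝ :=
  limUnder atTop fun n : ℕ => entPart μ (joinN S α n) / n

noncomputable def hPlusC (μ : Measure X) (S : X → X) (U : Finset (Set X)) : ℝ :=
  sInf {h | ∃ α : Finset (Set X), IsMPartition α ∧ Refines α U ∧ h = hPart μ S α}

noncomputable def hMinusC (μ : Measure X) (S : X → X) (U : Finset (Set X)) : ℝ :=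
  limUnder atTop fun n : ℕ => entCover μ (joinN S U n) / n

noncomputable def covN (μ : Measure X) (V : Finset (Set X)) (ε : ℝ) : ℕ :=
  sInf {m | ∃ W ⊆ V, W.card = m ∧ 1 - ε < (μ (⋃₀ (W : Set (Set X)))).toReal}

noncomputable def covNfull (V : Finset (Set X)) : ℕ :=
  sInf {m | ∃ W ⊆ V, W.card = m ∧ ⋃₀ (W : Set (Set X)) = Set.univ}

set_option linter.unusedSectionVars false

/-! ### Shannon entropy of finite-valued functions -/

def FibresMeasurable {ι : Type*} (f : X → ι) : Prop := ∀ i, MeasurableSet (f ⁻¹' {i})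

noncomputable def ent {ι : Type*} [Fintype ι] (μ : Measure X) (f : X → ι) : ℝ :=
  ∑ i, Real.negMulLog (μ.real (f ⁻¹' {i}))

namespace FibresMeasurable

variable {ι κ : Type*}

lemma preimage [Fintype ι] {f : X → ι} (hf : FibresMeasurable f) (s : Set ι) :
    MeasurableSet (f ⁻¹' s) := by
  have : f ⁻¹' s = ⋃ i ∈ s, f ⁻¹' {i} := by ext x; simp
  rw [this]
  exact MeasurableSet.biUnion (Set.to_countable s) fun i _ => hf i

lemma of_factorsThrough [Fintype ι] {f : X → ι} (hf : FibresMeasurable f) {g : X → κ}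
    (h : Function.FactorsThrough g f) : FibresMeasurable g := by
  intro k
  have : g ⁻¹' {k} = f ⁻¹' (f '' (g ⁻¹' {k})) := by
    ext x
    constructor
    · intro hx; exact ⟨x, hx, rfl⟩
    · rintro ⟨y, hy, hxy⟩
      have := h hxy
      simp_all
  rw [this]
  exact hf.preimage _

lemma prodMk {f : X → ι} {g : X → κ} (hf : FibresMeasurable f) (hg : FibresMeasurable g) :
    FibresMeasurable fun x => (f x, g x) := by
  rintro ⟨i, k⟩
  have : (fun x => (f x, g x)) ⁻¹' {(i, k)} = f ⁻¹' {i} ∩ g ⁻¹' {k} := by ext x; simp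
  rw [this]
  exact (hf i).inter (hg k)

lemma pi [Fintype κ] {F : κ → X → ι} (hF : ∀ k, FibresMeasurable (F k)) :
    FibresMeasurable fun x k => F k x := by
  intro c
  have : (fun x k => F k x) ⁻¹' {c} = ⋂ k, F k ⁻¹' {c k} := by
    ext x; simp [funext_iff]
  rw [this]
  exact MeasurableSet.iInter fun k => hF k (c k)

lemma comp {f : X → ι} (hf : FibresMeasurable f) {S : X → X} (hS : Measurable S) :
    FibresMeasurable fun x => f (S x) := fun i => hS (hf i)

lemma ofSet {A : Set X} (hA : MeasurableSet A) : FibresMeasurable fun x => x ∈ A := by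
  intro p
  by_cases hp : p
  · have : (fun x => x ∈ A) ⁻¹' {p} = A := by ext x; simp [hp]
    rwa [this]
  · have : (fun x => x ∈ A) ⁻¹' {p} = Aᶜ := by ext x; simp [hp]
    rw [this]; exact hA.compl

end FibresMeasurable

lemma negMulLog_sum_le {ι : Type*} (s : Finset ι) (a : ι → ℝ) (ha : ∀ i ∈ s, 0 ≤ a i) :
    Real.negMulLog (∑ i ∈ s, a i) ≤ ∑ i ∈ s, Real.negMulLog (a i) := by
  rw [Real.negMulLog, ← neg_mul_eq_neg_mul, Finset.sum_mul, ← Finset.sum_neg_distrib]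
  refine Finset.sum_le_sum fun i hi => ?_
  rcases (ha i hi).eq_or_lt with h | h
  · simp [← h]
  · have hle : a i ≤ ∑ j ∈ s, a j := Finset.single_le_sum ha hi
    have := Real.log_le_log h hle
    rw [Real.negMulLog]
    nlinarith

lemma negMulLog_le_two_mul_sqrt {t : ℝ} (ht : 0 ≤ t) : Real.negMulLog t ≤ 2 * √t := by
  rcases ht.eq_or_lt with h | h
  · simp [← h]
  · have hs : 0 < √t := Real.sqrt_pos.2 h
    have h1 := Real.one_sub_inv_le_log_of_pos hs
    have h2 : Real.log t = 2 * Real.log √t := by rw [Real.log_sqrt ht]; ring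
    have h3 : t = √t * √t := (Real.mul_self_sqrt ht).symm
    have h4 : t * (√t)⁻¹ = √t := by
      nth_rewrite 1 [h3]; field_simp
    rw [Real.negMulLog, h2]
    nlinarith

lemma negMulLog_le_one_sub {t : ℝ} (ht : 0 ≤ t) : Real.negMulLog t ≤ 1 - t := by
  rcases ht.eq_or_lt with h | h
  · simp [← h]
  · have h1 := Real.one_sub_inv_le_log_of_pos h
    have h4 : t * t⁻¹ = 1 := mul_inv_cancel₀ h.ne'
    rw [Real.negMulLog]
    nlinarith

section Entropy

variable {ι κ : Type*} [Fintype ι] [Fintype κ] {μ : Measure X}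

lemma ent_prodMk (f : X → ι) (g : X → κ) :
    ent μ (fun x => (f x, g x)) =
      ∑ k, ∑ i, Real.negMulLog (μ.real (f ⁻¹' {i} ∩ g ⁻¹' {k})) := by
  rw [ent, Fintype.sum_prod_type, Finset.sum_comm]
  refine Finset.sum_congr rfl fun k _ => Finset.sum_congr rfl fun i _ => ?_
  congr 2
  ext x; simp

lemma ent_comp {f : X → ι} (hf : FibresMeasurable f) {S : X → X}
    (hS : MeasurePreserving S μ μ) : ent μ (fun x => f (S x)) = ent μ f := by
  refine Finset.sum_congr rfl fun i _ => ?_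
  have : (fun x => f (S x)) ⁻¹' {i} = S ⁻¹' (f ⁻¹' {i}) := rfl
  rw [this, hS.measureReal_preimage (hf i).nullMeasurableSet]

variable [IsProbabilityMeasure μ]

lemma ent_nonneg (f : X → ι) : 0 ≤ ent μ f :=
  Finset.sum_nonneg fun _ _ => Real.negMulLog_nonneg measureReal_nonneg measureReal_le_one

lemma sum_measureReal_fibre {f : X → ι} (hf : FibresMeasurable f) (A : Set X) :
    ∑ i, μ.real (f ⁻¹' {i} ∩ A) = μ.real A := by
  have h := sum_measureReal_preimage_singleton (μ := μ.restrict A) Finset.univ (f := f)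
    fun i _ => hf i
  simp only [Finset.coe_univ, Set.preimage_univ] at h
  rw [measureReal_restrict_apply_univ] at h
  rw [← h]
  exact Finset.sum_congr rfl fun i _ => (measureReal_restrict_apply (hf i)).symm

lemma ent_prodMk_le {f : X → ι} {g : X → κ} (hf : FibresMeasurable f)
    (hg : FibresMeasurable g) : ent μ (fun x => (f x, g x)) ≤ ent μ f + ent μ g := by
  set p : ι → ℝ := fun i => μ.real (f ⁻¹' {i})
  set q : κ → ℝ := fun k => μ.real (g ⁻¹' {k})
  set r : ι → κ → ℝ := fun i k => μ.real (f ⁻¹' {i} ∩ g ⁻¹' {k})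
  have hq : ∀ k, ∑ i, r i k = q k := fun k => sum_measureReal_fibre hf _
  have hp : ∀ i, ∑ k, r i k = p i := fun i => by
    change _ = μ.real (f ⁻¹' {i})
    rw [← sum_measureReal_fibre hg (f ⁻¹' {i})]
    exact Finset.sum_congr rfl fun k _ => by rw [Set.inter_comm]
  have hp1 : ∑ i, p i = 1 := by
    have := sum_measureReal_fibre (μ := μ) hf Set.univ
    simpa [p] using this
  have hq1 : ∑ k, q k = 1 := by
    have := sum_measureReal_fibre (μ := μ) hg Set.univ
    simpa [q] using this
  have key : ∀ k i, Real.negMulLog (r i k) ≤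
      (-(r i k * Real.log (p i)) - r i k * Real.log (q k)) + (p i * q k - r i k) := by
    intro k i
    have hr0 : 0 ≤ r i k := measureReal_nonneg
    have hrp : r i k ≤ p i := measureReal_mono Set.inter_subset_left
    have hrq : r i k ≤ q k := measureReal_mono Set.inter_subset_right
    rcases hr0.eq_or_lt with h | h
    · have : 0 ≤ p i * q k := mul_nonneg (hr0.trans hrp) (hr0.trans hrq)
      simp [← h, this]
    · have hpp := h.trans_le hrp
      have hqq := h.trans_le hrq
      have h1 := Real.log_le_sub_one_of_pos (div_pos (mul_pos hpp hqq) h)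
      rw [Real.log_div (mul_pos hpp hqq).ne' h.ne', Real.log_mul hpp.ne' hqq.ne'] at h1
      have h2 := mul_le_mul_of_nonneg_left h1 h.le
      have h3 : r i k * (p i * q k / r i k - 1) = p i * q k - r i k := by field_simp
      rw [h3] at h2
      rw [Real.negMulLog]
      nlinarith
  have e1 : ∑ k, ∑ i, r i k * Real.log (p i) = ∑ i, p i * Real.log (p i) := by
    rw [Finset.sum_comm]
    exact Finset.sum_congr rfl fun i _ => by rw [← Finset.sum_mul, hp]
  have e2 : ∑ k, ∑ i, r i k * Real.log (q k) = ∑ k, q k * Real.log (q k) :=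
    Finset.sum_congr rfl fun k _ => by rw [← Finset.sum_mul, hq]
  have e3 : ∑ k, ∑ i, p i * q k = 1 := by
    simp_rw [← Finset.sum_mul, hp1, one_mul, hq1]
  have e4 : ∑ k, ∑ i, r i k = 1 := by simp_rw [hq, hq1]
  calc ent μ (fun x => (f x, g x)) = ∑ k, ∑ i, Real.negMulLog (r i k) := ent_prodMk f g
    _ ≤ ∑ k, ∑ i, ((-(r i k * Real.log (p i)) - r i k * Real.log (q k))
          + (p i * q k - r i k)) :=
        Finset.sum_le_sum fun k _ => Finset.sum_le_sum fun i _ => key k i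
    _ = ent μ f + ent μ g := by
        simp only [Finset.sum_add_distrib, Finset.sum_sub_distrib, Finset.sum_neg_distrib,
          e1, e2, e3, e4]
        simp only [ent, Real.negMulLog, neg_mul, Finset.sum_neg_distrib]
        ring

lemma ent_le_of_factorsThrough {f : X → ι} (hf : FibresMeasurable f) {g : X → κ}
    (h : Function.FactorsThrough g f) : ent μ g ≤ ent μ f := by
  have : Nonempty X := nonempty_of_isProbabilityMeasure μ
  have : Nonempty κ := this.map g
  obtain ⟨φ, rfl⟩ := (Function.factorsThrough_iff _).1 h
  rw [ent, ent, ← Finset.sum_fiberwise Finset.univ φ]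
  refine Finset.sum_le_sum fun k _ => ?_
  have : μ.real ((φ ∘ f) ⁻¹' {k}) = ∑ i with φ i = k, μ.real (f ⁻¹' {i}) := by
    rw [sum_measureReal_preimage_singleton _ fun i _ => hf i]
    congr 1
    ext x; simp
  rw [this]
  exact negMulLog_sum_le _ _ fun _ _ => measureReal_nonneg

lemma ent_pi_le {m : ℕ} {F : Fin m → X → ι} (hF : ∀ k, FibresMeasurable (F k)) :
    ent μ (fun x k => F k x) ≤ ∑ k, ent μ (F k) := by
  induction m with
  | zero =>
    have : ∀ c : Fin 0 → ι, (fun (x : X) k => F k x) ⁻¹' {c} = Set.univ := by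
      intro c; ext x; simp [Subsingleton.elim _ c]
    simp [ent, this]
  | succ m ih =>
    rw [Fin.sum_univ_castSucc]
    have h1 : FibresMeasurable fun x (k : Fin m) => F k.castSucc x :=
      FibresMeasurable.pi fun k => hF _
    refine (ent_le_of_factorsThrough (h1.prodMk (hF (Fin.last m))) ?_).trans
      ((ent_prodMk_le h1 (hF _)).trans (by gcongr; exact ih fun k => hF _))
    intro x y hxy
    simp only [Prod.mk.injEq, funext_iff] at hxy
    funext k
    refine Fin.lastCases hxy.2 hxy.1 k

end Entropy

/-! ### Partitions as fibres of functions -/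

/-- The nonempty members of `α` are exactly the nonempty fibres of `f`. -/
def Represents {ι : Type*} (α : Finset (Set X)) (f : X → ι) : Prop :=
  (∀ x, f ⁻¹' {f x} ∈ α) ∧ ∀ A ∈ α, ∀ x ∈ A, A = f ⁻¹' {f x}

noncomputable def fibrePartition {ι : Type*} [Fintype ι] (f : X → ι) : Finset (Set X) :=
  Finset.univ.image fun i => f ⁻¹' {i}

def block {ι : Type*} (S : X → X) (f : X → ι) (n : ℕ) : X → Fin n → ι :=
  fun x k => f (S^[k] x)

section Represents

variable {ι κ : Type*}

lemma represents_fibrePartition [Fintype ι] (f : X → ι) :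
    Represents (fibrePartition f) f := by
  refine ⟨fun x => Finset.mem_image_of_mem _ (Finset.mem_univ _), fun A hA x hx => ?_⟩
  obtain ⟨i, -, rfl⟩ := Finset.mem_image.1 hA
  rw [show f x = i from hx]

lemma Represents.congr {α : Finset (Set X)} {f : X → ι} {g : X → κ} (h : Represents α f)
    (hfg : ∀ x y, f x = f y ↔ g x = g y) : Represents α g := by
  have : ∀ x, g ⁻¹' {g x} = f ⁻¹' {f x} := fun x => by
    ext y; simp [hfg]
  exact ⟨fun x => this x ▸ h.1 x, fun A hA x hx => this x ▸ h.2 A hA x hx⟩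

lemma Represents.isMPartition {α : Finset (Set X)} {f : X → ι} (h : Represents α f)
    (hf : FibresMeasurable f) : IsMPartition α := by
  refine ⟨⟨fun A hA => ?_, ?_⟩, fun A hA B hB hAB => ?_⟩
  · rcases A.eq_empty_or_nonempty with rfl | ⟨x, hx⟩
    · exact MeasurableSet.empty
    · rw [h.2 A hA x hx]; exact hf _
  · exact Set.eq_univ_of_forall fun x => ⟨_, h.1 x, rfl⟩
  · rw [Set.disjoint_left]
    intro x hxA hxB
    exact hAB ((h.2 A hA x hxA).trans (h.2 B hB x hxB).symm)

lemma Represents.entPart_eq [Fintype ι] {α : Finset (Set X)} {f : X → ι}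
    (h : Represents α f) (μ : Measure X) : entPart μ α = ent μ f := by
  have e1 : entPart μ α = ∑ A ∈ α with A.Nonempty, Real.negMulLog (μ.real A) := by
    rw [Finset.sum_filter_of_ne]
    · rfl
    · intro A _ hA
      by_contra hne
      rw [Set.not_nonempty_iff_eq_empty] at hne
      simp [hne] at hA
  have e2 : ent μ f = ∑ i with (f ⁻¹' {i}).Nonempty, Real.negMulLog (μ.real (f ⁻¹' {i})) := by
    rw [Finset.sum_filter_of_ne]
    · rfl
    · intro i _ hA
      by_contra hne
      rw [Set.not_nonempty_iff_eq_empty] at hne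
      simp [hne] at hA
  have e3 : α.filter (fun A => A.Nonempty) =
      (Finset.univ.filter fun i => (f ⁻¹' {i}).Nonempty).image fun i => f ⁻¹' {i} := by
    ext A
    simp only [Finset.mem_filter, Finset.mem_image, Finset.mem_univ, true_and]
    constructor
    · rintro ⟨hA, x, hx⟩
      exact ⟨f x, ⟨x, rfl⟩, (h.2 A hA x hx).symm⟩
    · rintro ⟨_, ⟨x, rfl⟩, rfl⟩
      exact ⟨h.1 x, x, rfl⟩
  rw [e1, e2, e3, Finset.sum_image]
  intro i hi j _ hij
  obtain ⟨x, hx⟩ := (Finset.mem_filter.1 (Finset.mem_coe.1 hi)).2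
  have hx' : x ∈ f ⁻¹' {j} := by rw [← show f ⁻¹' {i} = f ⁻¹' {j} from hij]; exact hx
  exact (show f x = i from hx).symm.trans hx'

lemma Represents.cJoin {α β : Finset (Set X)} {f : X → ι} {g : X → κ}
    (hf : Represents α f) (hg : Represents β g) :
    Represents (cJoin α β) fun x => (f x, g x) := by
  have hfib : ∀ x, (fun x => (f x, g x)) ⁻¹' {(f x, g x)} = f ⁻¹' {f x} ∩ g ⁻¹' {g x} :=
    fun x => by ext y; simp
  refine ⟨fun x => ?_, fun A hA x hx => ?_⟩
  · rw [hfib]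
    exact Finset.mem_image.2 ⟨(_, _), Finset.mem_product.2 ⟨hf.1 x, hg.1 x⟩, rfl⟩
  · obtain ⟨⟨B, C⟩, hBC, rfl⟩ := Finset.mem_image.1 hA
    rw [Finset.mem_product] at hBC
    rw [hfib, ← hf.2 B hBC.1 x hx.1, ← hg.2 C hBC.2 x hx.2]

lemma Represents.preC {α : Finset (Set X)} {f : X → ι} (hf : Represents α f) (S : X → X) :
    Represents (preC S α) fun x => f (S x) := by
  refine ⟨fun x => Finset.mem_image.2 ⟨_, hf.1 (S x), rfl⟩, fun A hA x hx => ?_⟩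
  obtain ⟨B, hB, rfl⟩ := Finset.mem_image.1 hA
  change S ⁻¹' B = S ⁻¹' (f ⁻¹' {f (S x)})
  rw [← hf.2 B hB (S x) hx]

lemma Represents.joinN {α : Finset (Set X)} {f : X → ι} (hf : Represents α f) (S : X → X)
    (n : ℕ) : Represents (joinN S α n) (block S f n) := by
  induction n with
  | zero =>
    have hfib : ∀ x, block S f 0 ⁻¹' {block S f 0 x} = Set.univ := fun x =>
      Set.eq_univ_of_forall fun y => Subsingleton.elim _ _
    refine ⟨fun x => ?_, fun A hA x _ => ?_⟩
    · rw [hfib]; exact Finset.mem_singleton_self _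
    · rw [hfib]; exact Finset.mem_singleton.1 hA
  | succ n ih =>
    refine (ih.cJoin (hf.preC S^[n])).congr fun x y => ?_
    simp only [block, Prod.mk.injEq, funext_iff, Fin.forall_fin_succ', Fin.val_castSucc,
      Fin.val_last]

lemma IsMPartition.exists_represents {α : Finset (Set X)} (hα : IsMPartition α) :
    ∃ f : X → α, FibresMeasurable f ∧ Represents α f ∧ ∀ x, x ∈ (f x : Set X) := by
  have hex : ∀ x, ∃ A : α, x ∈ (A : Set X) := fun x => by
    have : x ∈ ⋃₀ (α : Set (Set X)) := hα.1.2 ▸ Set.mem_univ x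
    obtain ⟨A, hA, hx⟩ := this
    exact ⟨⟨A, hA⟩, hx⟩
  choose f hf using hex
  have huniq : ∀ A : α, f ⁻¹' {A} = A := fun A => by
    ext x
    refine ⟨fun hx => ?_, fun hx => ?_⟩
    · rw [← show f x = A from hx]; exact hf x
    · by_contra hne
      have hne' : (f x : Set X) ≠ A := fun h => hne (Subtype.ext h)
      exact Set.disjoint_left.1 (hα.2 _ (f x).2 _ A.2 hne') (hf x) hx
  refine ⟨f, fun A => ?_, ⟨fun x => ?_, fun A hA x hx => ?_⟩, hf⟩
  · rw [huniq]; exact hα.1.1 _ A.2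
  · rw [huniq]; exact (f x).2
  · have : f x = ⟨A, hA⟩ := by
      have : x ∈ f ⁻¹' {⟨A, hA⟩} := by rw [huniq]; exact hx
      exact this
    rw [this, huniq]

lemma IsMCover.exists_selector {U : Finset (Set X)} (hU : IsMCover U) :
    ∃ g : X → U, FibresMeasurable g ∧ ∀ x, x ∈ (g x : Set X) := by
  have hex : ∀ x, ∃ A : U, x ∈ (A : Set X) := fun x => by
    have : x ∈ ⋃₀ (U : Set (Set X)) := hU.2 ▸ Set.mem_univ x
    obtain ⟨A, hA, hx⟩ := this
    exact ⟨⟨A, hA⟩, hx⟩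
  have hF : FibresMeasurable fun x (A : U) => x ∈ (A : Set X) :=
    FibresMeasurable.pi fun A => FibresMeasurable.ofSet (hU.1 A A.2)
  refine ⟨fun x => (hex x).choose, hF.of_factorsThrough fun x y hxy => ?_,
    fun x => (hex x).choose_spec⟩
  have : ∀ A : U, (x ∈ (A : Set X)) = (y ∈ (A : Set X)) := congrFun hxy
  simp only [this]

end Represents

lemma exists_superset_mem_joinN {S : X → X} {U : Finset (Set X)} {n : ℕ} {A : Set X} :
    (∃ B ∈ joinN S U n, A ⊆ B) ↔ ∀ k < n, ∃ C ∈ U, ∀ x ∈ A, S^[k] x ∈ C := by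
  induction n with
  | zero => simp [joinN]
  | succ n ih =>
    rw [Nat.forall_lt_succ_right, ← ih]
    constructor
    · rintro ⟨_, hB, hAB⟩
      obtain ⟨⟨C, D⟩, hCD, rfl⟩ := Finset.mem_image.1 hB
      rw [Finset.mem_product] at hCD
      obtain ⟨E, hE, hED⟩ := Finset.mem_image.1 hCD.2
      refine ⟨⟨C, hCD.1, fun x hx => (hAB hx).1⟩, E, hE, fun x hx => ?_⟩
      have : x ∈ S^[n] ⁻¹' E := hED ▸ (hAB hx).2
      exact this
    · rintro ⟨⟨C, hC, hAC⟩, E, hE, hAE⟩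
      exact ⟨C ∩ S^[n] ⁻¹' E, Finset.mem_image.2
        ⟨(C, S^[n] ⁻¹' E), Finset.mem_product.2 ⟨hC, Finset.mem_image_of_mem _ hE⟩, rfl⟩,
        fun x hx => ⟨hAC hx, hAE x hx⟩⟩

lemma refines_joinN {S : X → X} {U β : Finset (Set X)} {n : ℕ} :
    Refines β (joinN S U n) ↔ ∀ A ∈ β, ∀ k < n, ∃ C ∈ U, ∀ x ∈ A, S^[k] x ∈ C :=
  forall₂_congr fun _ _ => exists_superset_mem_joinN

lemma Refines.joinN {S : X → X} {α U : Finset (Set X)} (h : Refines α U) (n : ℕ) :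
    Refines (joinN S α n) (joinN S U n) := by
  rw [refines_joinN]
  intro A hA k hk
  obtain ⟨C, hC, hAC⟩ := exists_superset_mem_joinN.1 ⟨A, hA, subset_rfl⟩ k hk
  obtain ⟨D, hD, hCD⟩ := h C hC
  exact ⟨D, hD, fun x hx => hCD (hAC x hx)⟩

lemma Refines.cJoin_preC_iterate {S : X → X} {U α β : Finset (Set X)} {m n : ℕ}
    (hα : Refines α (_root_.joinN S U m)) (hβ : Refines β (_root_.joinN S U n)) :
    Refines (cJoin α (preC S^[m] β)) (_root_.joinN S U (m + n)) := by
  rw [refines_joinN] at *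
  intro A hA k hk
  obtain ⟨⟨B, D⟩, hBD, rfl⟩ := Finset.mem_image.1 hA
  rw [Finset.mem_product] at hBD
  obtain ⟨C, hC, hCD⟩ := Finset.mem_image.1 hBD.2
  rcases lt_or_ge k m with h | h
  · obtain ⟨V, hV, hBV⟩ := hα B hBD.1 k h
    exact ⟨V, hV, fun x hx => hBV x hx.1⟩
  · obtain ⟨V, hV, hBV⟩ := hβ C hC (k - m) (by omega)
    refine ⟨V, hV, fun x hx => ?_⟩
    have hx' : x ∈ S^[m] ⁻¹' C := by rw [show S^[m] ⁻¹' C = D from hCD]; exact hx.2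
    have := hBV _ hx'
    rwa [← Function.iterate_add_apply, Nat.sub_add_cancel h] at this

/-! ### Existence of the limits -/

section Limits

variable {ι : Type*} [Fintype ι] {μ : Measure X} {S : X → X}

lemma FibresMeasurable.block {f : X → ι} (hf : FibresMeasurable f) (hS : Measurable S)
    (n : ℕ) : FibresMeasurable (block S f n) :=
  FibresMeasurable.pi fun k => hf.comp (hS.iterate k)

lemma entPart_nonneg [IsProbabilityMeasure μ] (α : Finset (Set X)) : 0 ≤ entPart μ α :=
  Finset.sum_nonneg fun _ _ => Real.negMulLog_nonneg measureReal_nonneg measureReal_le_one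

lemma subadditive_ent_block [IsProbabilityMeasure μ] (hS : MeasurePreserving S μ μ) {f : X → ι}
    (hf : FibresMeasurable f) : Subadditive fun n => ent μ (block S f n) := by
  intro m n
  have hm := hf.block hS.measurable m
  have hn := hf.block hS.measurable n
  beta_reduce
  rw [← ent_comp hn (hS.iterate m)]
  refine (ent_le_of_factorsThrough (hm.prodMk (hn.comp (hS.iterate m).measurable)) ?_).trans
    (ent_prodMk_le hm (hn.comp (hS.iterate m).measurable))
  intro x y hxy
  simp only [_root_.block, Prod.mk.injEq, funext_iff, ← Function.iterate_add_apply] at hxy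
  funext k
  refine Fin.addCases (fun i => by simpa [_root_.block] using hxy.1 i) (fun i => ?_) k
  simpa [_root_.block, add_comm] using hxy.2 i

lemma tendsto_hPart [IsProbabilityMeasure μ] (hS : MeasurePreserving S μ μ) {α : Finset (Set X)}
    (hα : IsMPartition α) :
    Tendsto (fun n : ℕ => entPart μ (joinN S α n) / n) atTop (𝓝 (hPart μ S α)) := by
  obtain ⟨f, hf, hαf, -⟩ := hα.exists_represents
  have hsub := subadditive_ent_block hS hf
  refine tendsto_nhds_limUnder ⟨hsub.lim, ?_⟩
  simp only [(hαf.joinN S _).entPart_eq μ]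
  refine hsub.tendsto_lim ⟨0, ?_⟩
  rintro _ ⟨n, rfl⟩
  exact div_nonneg (ent_nonneg _) n.cast_nonneg

lemma hPart_nonneg [IsProbabilityMeasure μ] (hS : MeasurePreserving S μ μ) {α : Finset (Set X)}
    (hα : IsMPartition α) : 0 ≤ hPart μ S α :=
  ge_of_tendsto' (tendsto_hPart hS hα) fun n => div_nonneg (entPart_nonneg _) n.cast_nonneg

lemma hPlusC_le [IsProbabilityMeasure μ] (hS : MeasurePreserving S μ μ) {α U : Finset (Set X)}
    (hα : IsMPartition α) (hαU : Refines α U) : hPlusC μ S U ≤ hPart μ S α := by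
  refine csInf_le ⟨0, ?_⟩ ⟨α, hα, hαU, rfl⟩
  rintro _ ⟨β, hβ, -, rfl⟩
  exact hPart_nonneg hS hβ

lemma IsMCover.exists_refining_partition {U : Finset (Set X)} (hU : IsMCover U) :
    ∃ α, IsMPartition α ∧ Refines α U := by
  obtain ⟨g, hg, hgU⟩ := hU.exists_selector
  refine ⟨fibrePartition g, (represents_fibrePartition g).isMPartition hg, fun A hA => ?_⟩
  obtain ⟨i, -, rfl⟩ := Finset.mem_image.1 hA
  refine ⟨i, i.2, fun x hx => ?_⟩
  rw [← show g x = i from hx]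
  exact hgU x

lemma IsMPartition.joinN {α : Finset (Set X)} (hα : IsMPartition α) (hS : Measurable S)
    (n : ℕ) : IsMPartition (joinN S α n) := by
  obtain ⟨f, hf, hαf, -⟩ := hα.exists_represents
  exact (hαf.joinN S n).isMPartition (hf.block hS n)

lemma entCover_le [IsProbabilityMeasure μ] {α U : Finset (Set X)}
    (hα : IsMPartition α) (hαU : Refines α U) : entCover μ U ≤ entPart μ α := by
  refine csInf_le ⟨0, ?_⟩ ⟨α, hα, hαU, rfl⟩
  rintro _ ⟨β, -, -, rfl⟩
  exact entPart_nonneg β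

lemma entCover_nonneg [IsProbabilityMeasure μ] (U : Finset (Set X)) : 0 ≤ entCover μ U := by
  refine Real.sInf_nonneg ?_
  rintro _ ⟨β, -, -, rfl⟩
  exact entPart_nonneg β

lemma IsMCover.le_entCover_joinN {U : Finset (Set X)} (hU : IsMCover U) (hS : Measurable S)
    {n : ℕ} {c : ℝ}
    (h : ∀ β, IsMPartition β → Refines β (_root_.joinN S U n) → c ≤ entPart μ β) :
    c ≤ entCover μ (_root_.joinN S U n) := by
  obtain ⟨α, hα, hαU⟩ := hU.exists_refining_partition
  refine le_csInf ⟨_, _, hα.joinN hS n, hαU.joinN n, rfl⟩ ?_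
  rintro _ ⟨β, hβ, hβU, rfl⟩
  exact h β hβ hβU

lemma subadditive_entCover [IsProbabilityMeasure μ] (hS : MeasurePreserving S μ μ)
    {U : Finset (Set X)} (hU : IsMCover U) :
    Subadditive fun n => entCover μ (joinN S U n) := by
  intro m n
  rw [← sub_le_iff_le_add]
  refine hU.le_entCover_joinN hS.measurable fun α hα hαU => ?_
  rw [sub_le_comm]
  refine hU.le_entCover_joinN hS.measurable fun β hβ hβU => ?_
  rw [sub_le_iff_le_add']
  obtain ⟨f, hf, hαf, -⟩ := hα.exists_represents
  obtain ⟨g, hg, hβg, -⟩ := hβ.exists_represents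
  have hS' := hS.iterate m
  have hrep := hαf.cJoin (hβg.preC S^[m])
  have hg' := hg.comp hS'.measurable
  refine (entCover_le (hrep.isMPartition (hf.prodMk hg'))
    (hαU.cJoin_preC_iterate hβU)).trans ?_
  rw [hrep.entPart_eq, hαf.entPart_eq, hβg.entPart_eq, ← ent_comp hg hS']
  exact ent_prodMk_le hf hg'

lemma tendsto_hMinusC [IsProbabilityMeasure μ] (hS : MeasurePreserving S μ μ)
    {U : Finset (Set X)} (hU : IsMCover U) :
    Tendsto (fun n : ℕ => entCover μ (joinN S U n) / n) atTop (𝓝 (hMinusC μ S U)) := by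
  have hsub := subadditive_entCover hS hU
  refine tendsto_nhds_limUnder ⟨hsub.lim, hsub.tendsto_lim ⟨0, ?_⟩⟩
  rintro _ ⟨n, rfl⟩
  exact div_nonneg (entCover_nonneg _) n.cast_nonneg

lemma hMinusC_le_hPlusC [IsProbabilityMeasure μ] (hS : MeasurePreserving S μ μ)
    {U : Finset (Set X)} (hU : IsMCover U) : hMinusC μ S U ≤ hPlusC μ S U := by
  obtain ⟨α, hα, hαU⟩ := hU.exists_refining_partition
  refine le_csInf ⟨_, α, hα, hαU, rfl⟩ ?_
  rintro _ ⟨β, hβ, hβU, rfl⟩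
  refine le_of_tendsto_of_tendsto' (tendsto_hMinusC hS hU) (tendsto_hPart hS hβ) fun n => ?_
  gcongr
  exact entCover_le (hβ.joinN hS.measurable n) (hβU.joinN n)

end Limits

/-! ### Markers and towers -/

/-- The `k`-th iterate of `T`, for an integer `k`. -/
def orbit (T : X ≃ᵐ X) (k : ℤ) : X → X := ⇑((T.toEquiv : Equiv.Perm X) ^ k)

section Orbit

variable (T : X ≃ᵐ X)

@[simp] lemma orbit_zero (x : X) : orbit T 0 x = x := rfl

@[simp] lemma orbit_orbit (k l : ℤ) (x : X) : orbit T k (orbit T l x) = orbit T (k + l) x := by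
  simp [orbit, zpow_add]

lemma orbit_natCast (n : ℕ) : orbit T n = T^[n] := by
  rw [orbit, zpow_natCast, ← Equiv.Perm.iterate_eq_pow]
  rfl

lemma orbit_neg_natCast (n : ℕ) : orbit T (-n) = T.symm^[n] := by
  rw [orbit, zpow_neg, zpow_natCast, ← inv_pow, ← Equiv.Perm.iterate_eq_pow]
  rfl

lemma measurable_orbit (k : ℤ) : Measurable (orbit T k) := by
  obtain ⟨n, rfl | rfl⟩ := k.eq_nat_or_neg
  · rw [orbit_natCast]; exact T.measurable.iterate n
  · rw [orbit_neg_natCast]; exact T.symm.measurable.iterate n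

variable {T}

lemma measurePreserving_orbit {μ : Measure X} (hT : MeasurePreserving T μ μ) (k : ℤ) :
    MeasurePreserving (orbit T k) μ μ := by
  obtain ⟨n, rfl | rfl⟩ := k.eq_nat_or_neg
  · rw [orbit_natCast]; exact hT.iterate n
  · rw [orbit_neg_natCast]; exact (hT.symm T).iterate n

lemma orbit_injective (k : ℤ) : Function.Injective (orbit T k) :=
  Equiv.injective _

lemma measureReal_orbit_preimage {μ : Measure X} (hT : MeasurePreserving T μ μ) (k : ℤ)
    {A : Set X} (hA : MeasurableSet A) : μ.real (orbit T k ⁻¹' A) = μ.real A :=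
  (measurePreserving_orbit hT k).measureReal_preimage hA.nullMeasurableSet

/-- Points with no period in `[1, N]`. -/
def nonPeriodic (T : X ≃ᵐ X) (N : ℕ) : Set X :=
  {x | ∀ i : ℕ, 1 ≤ i → i ≤ N → orbit T i x ≠ x}

lemma orbit_mem_nonPeriodic {N : ℕ} {x : X} (k : ℤ) :
    orbit T k x ∈ nonPeriodic T N ↔ x ∈ nonPeriodic T N := by
  refine forall₃_congr fun i _ _ => not_congr ?_
  rw [orbit_orbit, add_comm, ← orbit_orbit, (orbit_injective k).eq_iff]

/-- The points whose orbit visits `B` at some time in `[-N, N]`. -/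
def orbitNhd (T : X ≃ᵐ X) (N : ℕ) (B : Set X) : Set X :=
  {x | ∃ i : ℤ, |i| ≤ N ∧ orbit T i x ∈ B}

lemma measurableSet_orbitNhd (N : ℕ) {B : Set X} (hB : MeasurableSet B) :
    MeasurableSet (orbitNhd T N B) := by
  have : orbitNhd T N B = ⋃ i : ℤ, ⋃ _ : |i| ≤ N, orbit T i ⁻¹' B := by
    ext x; simp [orbitNhd]
  rw [this]
  exact MeasurableSet.iUnion fun i => MeasurableSet.iUnion fun _ => measurable_orbit T i hB

/-- Greedy choice of a maximal separated set from a sequence of separated sets. -/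
def greedy (T : X ≃ᵐ X) (N : ℕ) (C : ℕ → Set X) : ℕ → Set X
  | 0 => ∅
  | k + 1 => greedy T N C k ∪ (C k \ orbitNhd T N (greedy T N C k))

lemma measurableSet_greedy (N : ℕ) {C : ℕ → Set X} (hC : ∀ k, MeasurableSet (C k)) (k : ℕ) :
    MeasurableSet (greedy T N C k) := by
  induction k with
  | zero => exact MeasurableSet.empty
  | succ k ih => exact ih.union ((hC k).diff (measurableSet_orbitNhd N ih))

def Separated (T : X ≃ᵐ X) (N : ℕ) (A : Set X) : Prop :=
  ∀ x ∈ A, ∀ i : ℕ, 1 ≤ i → i ≤ N → orbit T i x ∉ A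

lemma separated_greedy {N : ℕ} {C : ℕ → Set X} (hC : ∀ k, Separated T N (C k)) (k : ℕ) :
    Separated T N (greedy T N C k) := by
  induction k with
  | zero => exact fun x hx => hx.elim
  | succ k ih =>
    rintro x (hx | hx) i hi hiN (hy | hy)
    · exact ih x hx i hi hiN hy
    · refine hy.2 ⟨-i, ?_, by simpa using hx⟩
      rw [abs_neg, Nat.abs_cast]; exact_mod_cast hiN
    · refine hx.2 ⟨i, ?_, hy⟩
      rw [Nat.abs_cast]; exact_mod_cast hiN
    · exact hC k x hx.1 i hi hiN hy.1

lemma exists_separated_cover [StandardBorelSpace X] (T : X ≃ᵐ X) (N : ℕ) :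
    ∃ C : ℕ → Set X, (∀ k, MeasurableSet (C k)) ∧ (∀ k, Separated T N (C k)) ∧
      nonPeriodic T N ⊆ ⋃ k, C k := by
  obtain ⟨e, he⟩ := exists_measurableEmbedding_real X
  have hb := TopologicalSpace.isBasis_countableBasis ℝ
  have hne : (TopologicalSpace.countableBasis ℝ).Nonempty := by
    obtain ⟨W, hW, -⟩ := hb.exists_subset_of_mem_open (Set.mem_univ (0 : ℝ)) isOpen_univ
    exact ⟨W, hW⟩
  obtain ⟨V, hV⟩ := (TopologicalSpace.countable_countableBasis ℝ).exists_eq_range hne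
  have hVo : ∀ k, MeasurableSet (V k) := fun k =>
    (hb.isOpen (hV ▸ Set.mem_range_self k)).measurableSet
  refine ⟨fun k => {x | e x ∈ V k ∧ ∀ i : ℕ, 1 ≤ i → i ≤ N → e (orbit T i x) ∉ V k},
    fun k => ?_, fun k x hx i hi hiN hy => hx.2 i hi hiN hy.1, fun x hx => ?_⟩
  · have : {x | e x ∈ V k ∧ ∀ i : ℕ, 1 ≤ i → i ≤ N → e (orbit T i x) ∉ V k} =
        e ⁻¹' V k ∩ ⋂ i : ℕ, ⋂ _ : 1 ≤ i, ⋂ _ : i ≤ N, (orbit T i ⁻¹' (e ⁻¹' V k))ᶜ := by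
      ext x; simp
    beta_reduce
    rw [this]
    refine (he.measurable (hVo k)).inter (MeasurableSet.iInter fun i => MeasurableSet.iInter
      fun _ => MeasurableSet.iInter fun _ => ?_)
    exact (measurable_orbit T i (he.measurable (hVo k))).compl
  · set F : Set ℝ := (fun i : ℕ => e (orbit T i x)) '' Set.Icc 1 N
    have hF : IsOpen Fᶜ := ((Set.finite_Icc 1 N).image _).isClosed.isOpen_compl
    have hxF : e x ∈ Fᶜ := by
      rintro ⟨i, hi, hix⟩
      exact hx i hi.1 hi.2 (he.injective hix)
    obtain ⟨W, hW, hxW, hWF⟩ := hb.exists_subset_of_mem_open hxF hF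
    rw [hV] at hW
    obtain ⟨k, rfl⟩ := hW
    exact Set.mem_iUnion.2 ⟨k, hxW, fun i hi hiN h => hWF h ⟨i, ⟨hi, hiN⟩, rfl⟩⟩

lemma exists_marker [StandardBorelSpace X] (T : X ≃ᵐ X) (N : ℕ) :
    ∃ B : Set X, MeasurableSet B ∧ Separated T N B ∧ nonPeriodic T N = orbitNhd T N B := by
  obtain ⟨C, hCm, hCs, hC⟩ := exists_separated_cover T N
  have hmono : Monotone (greedy T N C) := monotone_nat_of_le_succ fun k => Set.subset_union_left
  have hsep : Separated T N (⋃ k, greedy T N C k) := by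
    intro x hx i hi hiN hy
    obtain ⟨k, hk⟩ := Set.mem_iUnion.1 hx
    obtain ⟨l, hl⟩ := Set.mem_iUnion.1 hy
    exact separated_greedy hCs (max k l) x (hmono (le_max_left _ _) hk) i hi hiN
      (hmono (le_max_right _ _) hl)
  refine ⟨⋃ k, greedy T N C k, MeasurableSet.iUnion (measurableSet_greedy N hCm), hsep, ?_⟩
  refine Set.Subset.antisymm (fun x hx => ?_) ?_
  · obtain ⟨k, hk⟩ := Set.mem_iUnion.1 (hC hx)
    by_cases h : x ∈ orbitNhd T N (greedy T N C k)
    · obtain ⟨i, hi, hxi⟩ := h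
      exact ⟨i, hi, Set.mem_iUnion.2 ⟨k, hxi⟩⟩
    · exact ⟨0, by simp, Set.mem_iUnion.2 ⟨k + 1, Or.inr ⟨hk, h⟩⟩⟩
  · rintro x ⟨i, -, hxi⟩
    rw [← orbit_mem_nonPeriodic i]
    intro j hj hjN h
    exact hsep _ hxi j hj hjN (h.symm ▸ hxi)

lemma measurableSet_nonPeriodic [StandardBorelSpace X] (T : X ≃ᵐ X) (N : ℕ) :
    MeasurableSet (nonPeriodic T N) := by
  obtain ⟨B, hB, -, h⟩ := exists_marker T N
  exact h ▸ measurableSet_orbitNhd N hB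

lemma Separated.mul_measureReal_le {N : ℕ} {B : Set X} (hB : MeasurableSet B)
    (h : Separated T N B) {μ : Measure X} [IsProbabilityMeasure μ]
    (hT : MeasurePreserving T μ μ) : (N + 1) * μ.real B ≤ 1 := by
  have hd : Set.PairwiseDisjoint (Finset.range (N + 1) : Set ℕ)
      fun i : ℕ => orbit T (-i) ⁻¹' B := by
    have aux : ∀ i j : ℕ, i < j → j ≤ N → ∀ x, orbit T (-i) x ∈ B → orbit T (-j) x ∉ B := by
      intro i j hij hj x hi hj'
      refine h _ hj' (j - i) (by omega) (by omega) ?_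
      rw [orbit_orbit]
      convert hi using 2
      push_cast [hij.le]; ring
    intro i hi j hj hij
    simp only [Finset.coe_range, Set.mem_Iio] at hi hj
    refine Set.disjoint_left.2 fun x hxi hxj => ?_
    rcases hij.lt_or_gt with hlt | hlt
    · exact aux i j hlt (by omega) x hxi hxj
    · exact aux j i hlt (by omega) x hxj hxi
  have := measureReal_biUnion_finset (μ := μ) hd fun i _ => measurable_orbit T (-i) hB
  simp only [measureReal_orbit_preimage hT _ hB, Finset.sum_const, Finset.card_range,
    nsmul_eq_mul] at this
  push_cast at this
  rw [← this]
  exact measureReal_le_one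

/-- The points not covered by the first `n` iterates of `E`. -/
def towerRest (T : X ≃ᵐ X) (n N : ℕ) (E : Set X) : Set X :=
  {x | x ∈ nonPeriodic T N ∧ ∀ i : ℕ, i < n → orbit T (-i) x ∉ E}

lemma measurableSet_towerRest [StandardBorelSpace X] (n N : ℕ) {E : Set X}
    (hE : MeasurableSet E) : MeasurableSet (towerRest T n N E) := by
  have : towerRest T n N E =
      nonPeriodic T N ∩ ⋂ i : ℕ, ⋂ _ : i < n, (orbit T (-i) ⁻¹' E)ᶜ := by
    ext x; simp [towerRest]
  rw [this]
  exact (measurableSet_nonPeriodic T N).inter (MeasurableSet.iInter fun i =>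
    MeasurableSet.iInter fun _ => (measurable_orbit T _ hE).compl)

lemma exists_tower [StandardBorelSpace X] {μ : Measure X} [IsProbabilityMeasure μ]
    (hT : MeasurePreserving T μ μ) {n : ℕ} (hn : 0 < n) (N : ℕ) :
    ∃ E, MeasurableSet E ∧ Separated T (n - 1) E ∧
      μ.real (towerRest T n N E) ≤ n ^ 2 / (N + 1) := by
  obtain ⟨B, hBm, hBs, hB⟩ := exists_marker T N
  set E : Set X := {x | (∃ m : ℕ, n ∣ m ∧ orbit T (-m) x ∈ B ∧ ∀ l : ℕ, l < m →
    orbit T (-l) x ∉ B) ∧ ∀ k : ℕ, 1 ≤ k → k < n → orbit T k x ∉ B} with hE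
  have hEm : MeasurableSet E := by
    have : E = (⋃ m : ℕ, ⋃ _ : n ∣ m, (orbit T (-m) ⁻¹' B ∩
        ⋂ l : ℕ, ⋂ _ : l < m, (orbit T (-l) ⁻¹' B)ᶜ)) ∩
        ⋂ k : ℕ, ⋂ _ : 1 ≤ k, ⋂ _ : k < n, (orbit T k ⁻¹' B)ᶜ := by
      ext x
      simp only [hE, Set.mem_ofPred_eq, Set.mem_inter_iff, Set.mem_iUnion, Set.mem_iInter,
        Set.mem_preimage, Set.mem_compl_iff, exists_prop]
    rw [this]
    refine MeasurableSet.inter (MeasurableSet.iUnion fun m => MeasurableSet.iUnion fun _ =>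
      (measurable_orbit T _ hBm).inter (MeasurableSet.iInter fun l =>
        MeasurableSet.iInter fun _ => (measurable_orbit T _ hBm).compl))
      (MeasurableSet.iInter fun k => MeasurableSet.iInter fun _ =>
        MeasurableSet.iInter fun _ => (measurable_orbit T _ hBm).compl)
  refine ⟨E, hEm, ?_, ?_⟩
  · rintro x ⟨⟨m, hnm, hm, hm'⟩, hx⟩ i hi hin ⟨⟨p, hnp, hp, hp'⟩, -⟩
    rw [orbit_orbit] at hp
    simp only [orbit_orbit] at hp'
    rcases lt_or_ge p i with h | h
    · refine hx (i - p) (by omega) (by omega) ?_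
      convert hp using 2
      push_cast [h.le]; ring
    · have h1 : m ≤ p - i := by
        by_contra hlt
        refine hm' (p - i) (by omega) ?_
        convert hp using 2
        push_cast [h]; ring
      have h2 : p ≤ m + i := by
        by_contra hlt
        refine hp' (m + i) (by omega) ?_
        convert hm using 2
        push_cast; ring
      have h3 : p = m + i := by omega
      rw [h3, Nat.dvd_add_right hnm] at hnp
      have := Nat.le_of_dvd (by omega) hnp
      omega
  · have hsub : towerRest T n N E ⊆
        ⋃ p ∈ Finset.range n ×ˢ Finset.range n, orbit T ((p.1 : ℤ) - p.2) ⁻¹' B := by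
      rintro x ⟨hxQ, hx⟩
      have hex : ∃ m : ℕ, orbit T (-m) x ∈ B := by
        rw [← orbit_mem_nonPeriodic (-N), hB] at hxQ
        obtain ⟨i, hi, hxi⟩ := hxQ
        rw [abs_le] at hi
        refine ⟨(N - i).toNat, ?_⟩
        rw [orbit_orbit] at hxi
        convert hxi using 2
        rw [Int.toNat_of_nonneg (by omega)]; ring
      set m := Nat.find hex
      have hm : orbit T (-m) x ∈ B := Nat.find_spec hex
      have hm' : ∀ l : ℕ, l < m → orbit T (-l) x ∉ B := fun l => Nat.find_min hex
      have hmod : m % n < n := Nat.mod_lt _ hn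
      have hle : m % n ≤ m := Nat.mod_le _ _
      have hnot := hx (m % n) hmod
      have hfirst : ∃ p : ℕ, n ∣ p ∧ orbit T (-p) (orbit T (-(m % n : ℕ)) x) ∈ B ∧
          ∀ l : ℕ, l < p → orbit T (-l) (orbit T (-(m % n : ℕ)) x) ∉ B := by
        refine ⟨m - m % n, Nat.dvd_sub_mod m, ?_, fun l hl => ?_⟩
        · rw [orbit_orbit]
          convert hm using 2
          push_cast [hle]; ring
        · rw [orbit_orbit]
          convert hm' (l + m % n) (by omega) using 3
          push_cast; ring
      have : ∃ k : ℕ, 1 ≤ k ∧ k < n ∧ orbit T k (orbit T (-(m % n : ℕ)) x) ∈ B := by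
        by_contra hcon
        push Not at hcon
        exact hnot ⟨hfirst, hcon⟩
      obtain ⟨k, -, hk, hkB⟩ := this
      rw [orbit_orbit] at hkB
      refine Set.mem_iUnion₂.2 ⟨(k, m % n), ?_, hkB⟩
      simp [hk, hmod]
    refine (measureReal_mono hsub (measure_ne_top _ _)).trans ((measureReal_biUnion_finset_le _ _).trans ?_)
    simp only [measureReal_orbit_preimage hT _ hBm, Finset.sum_const, Finset.card_product,
      Finset.card_range, nsmul_eq_mul]
    have h1 := hBs.mul_measureReal_le hBm hT
    rw [le_div_iff₀ (by positivity)]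
    push_cast
    nlinarith [sq_nonneg (n : ℝ)]

end Orbit

/-! ### Coding along a tower -/

section Coding

variable {ι κ : Type*} [Fintype ι] [Fintype κ] {T : X ≃ᵐ X} {μ : Measure X}
  [IsProbabilityMeasure μ]

lemma exists_tower_ent_le [StandardBorelSpace X] (hT : MeasurePreserving T μ μ) {n : ℕ}
    (hn : 0 < n) (N : ℕ) {b : X → ι} (hb : FibresMeasurable b) :
    ∃ E, MeasurableSet E ∧ μ.real (towerRest T n N E) ≤ n ^ 2 / (N + 1) ∧
      μ.real E ≤ 1 / n ∧
      ∑ i, Real.negMulLog (μ.real (b ⁻¹' {i} ∩ E)) ≤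
        ent μ b / n + Real.negMulLog (μ.real E) := by
  obtain ⟨E, hEm, hEs, hER⟩ := exists_tower hT hn N
  have hn' : (0 : ℝ) < n := by exact_mod_cast hn
  have hE1 : μ.real E ≤ 1 / n := by
    have h := hEs.mul_measureReal_le hEm hT
    rw [Nat.cast_sub hn] at h
    rw [le_div_iff₀ hn']
    push_cast at h
    linarith
  have hdisj : ∀ x, ∀ j k : Fin n, orbit T (-(j : ℕ)) x ∈ E → orbit T (-(k : ℕ)) x ∈ E → j = k := by
    have aux : ∀ x, ∀ j k : Fin n, j < k → orbit T (-(j : ℕ)) x ∈ E →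
        orbit T (-(k : ℕ)) x ∉ E := by
      intro x j k hjk hj hk
      rw [Fin.lt_def] at hjk
      refine hEs _ hk (k - j) (by omega) (by omega) ?_
      rw [orbit_orbit]
      convert hj using 2
      push_cast [hjk.le]; ring
    intro x j k hj hk
    by_contra hne
    rcases lt_or_gt_of_ne hne with h | h
    · exact aux x j k h hj hk
    · exact aux x k j h hk hj
  set s : X → Option (Fin n) := fun x =>
    if h : ∃ j : Fin n, orbit T (-(j : ℕ)) x ∈ E then some h.choose else none with hs
  have hfib : ∀ j, s ⁻¹' {some j} = orbit T (-(j : ℕ)) ⁻¹' E := by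
    intro j
    ext x
    simp only [Set.mem_preimage, Set.mem_singleton_iff, hs]
    constructor
    · intro h
      split_ifs at h with h'
      rw [← Option.some_inj.1 h]
      exact h'.choose_spec
    · intro h
      have h' : ∃ j : Fin n, orbit T (-(j : ℕ)) x ∈ E := ⟨j, h⟩
      rw [dif_pos h']
      exact congrArg some (hdisj x _ _ h'.choose_spec h)
  have hsm : FibresMeasurable s := by
    refine (FibresMeasurable.pi fun j : Fin n => FibresMeasurable.ofSet
      (measurable_orbit T (-(j : ℕ)) hEm)).of_factorsThrough fun x y hxy => ?_
    have : ∀ j : Fin n, (orbit T (-(j : ℕ)) x ∈ E) = (orbit T (-(j : ℕ)) y ∈ E) := congrFun hxy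
    simp only [hs, this]
  have hsum := ent_prodMk_le (μ := μ) hb hsm
  rw [ent_prodMk, ent, ent, Fintype.sum_option, Fintype.sum_option] at hsum
  have hnone : Real.negMulLog (μ.real (s ⁻¹' {none})) ≤
      ∑ i, Real.negMulLog (μ.real (b ⁻¹' {i} ∩ s ⁻¹' {none})) := by
    rw [← sum_measureReal_fibre hb (s ⁻¹' {none})]
    exact negMulLog_sum_le _ _ fun _ _ => measureReal_nonneg
  simp only [hfib, measureReal_orbit_preimage hT _ hEm] at hsum
  have hle : ∑ j : Fin n, (∑ i, Real.negMulLog (μ.real (b ⁻¹' {i} ∩ orbit T (-(j : ℕ)) ⁻¹' E)))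
      ≤ ∑ _j : Fin n, (ent μ b / n + Real.negMulLog (μ.real E)) := by
    have h1 : ∑ _j : Fin n, (ent μ b / n + Real.negMulLog (μ.real E)) =
        ent μ b + ∑ _j : Fin n, Real.negMulLog (μ.real E) := by
      simp only [Finset.sum_add_distrib, Finset.sum_const, Finset.card_univ, Fintype.card_fin,
        nsmul_eq_mul]
      field_simp
    rw [h1, ent]
    linarith
  have : Nonempty (Fin n) := ⟨⟨0, hn⟩⟩
  obtain ⟨j, -, hj⟩ := Finset.exists_le_of_sum_le Finset.univ_nonempty hle
  have hEj := measureReal_orbit_preimage hT (-(j : ℕ)) hEm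
  refine ⟨_, measurable_orbit T (-(j : ℕ)) hEm, ?_, ?_, ?_⟩
  · have : towerRest T n N (orbit T (-(j : ℕ)) ⁻¹' E) =
        orbit T (-(j : ℕ)) ⁻¹' towerRest T n N E := by
      ext x
      simp [towerRest, orbit_mem_nonPeriodic, add_comm]
    rw [this, measureReal_orbit_preimage hT _ (measurableSet_towerRest n N hEm)]
    exact hER
  · rwa [hEj]
  · rwa [hEj]

/-- Record `b` on `E`, `g` on the rest of `R`, and nothing elsewhere. -/
noncomputable def code (E R : Set X) (b : X → ι) (g : X → κ) (x : X) : Option (ι ⊕ κ) :=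
  if x ∈ E then some (Sum.inl (b x)) else if x ∈ R then some (Sum.inr (g x)) else none

lemma fibresMeasurable_code {E R : Set X} (hE : MeasurableSet E) (hR : MeasurableSet R)
    {b : X → ι} {g : X → κ} (hb : FibresMeasurable b) (hg : FibresMeasurable g) :
    FibresMeasurable (code E R b g) := by
  refine (((FibresMeasurable.ofSet hE).prodMk (FibresMeasurable.ofSet hR)).prodMk
    (hb.prodMk hg)).of_factorsThrough fun x y hxy => ?_
  simp only [Prod.mk.injEq] at hxy
  simp only [code, hxy.1.1, hxy.1.2, hxy.2.1, hxy.2.2]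

lemma code_eq_inl {E R : Set X} {b : X → ι} {g : X → κ} {x : X} {i : ι} :
    code E R b g x = some (Sum.inl i) ↔ x ∈ E ∧ b x = i := by
  unfold code; split_ifs <;> simp_all

lemma code_eq_inr {E R : Set X} {b : X → ι} {g : X → κ} {x : X} {k : κ} :
    code E R b g x = some (Sum.inr k) ↔ x ∉ E ∧ x ∈ R ∧ g x = k := by
  unfold code; split_ifs <;> simp_all

lemma code_eq_none {E R : Set X} {b : X → ι} {g : X → κ} {x : X} :
    code E R b g x = none ↔ x ∉ E ∪ R := by
  unfold code; split_ifs <;> simp_all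

lemma ent_code_le {E R : Set X} (hE : MeasurableSet E) (hR : MeasurableSet R)
    (b : X → ι) (g : X → κ) :
    ent μ (code E R b g) ≤ ∑ i, Real.negMulLog (μ.real (b ⁻¹' {i} ∩ E)) +
      Fintype.card κ * (2 * √(μ.real R)) + (μ.real E + μ.real R) := by
  have h1 : ∀ i, code E R b g ⁻¹' {some (Sum.inl i)} = b ⁻¹' {i} ∩ E := fun i => by
    ext x; simp [code_eq_inl, and_comm]
  have h2 : code E R b g ⁻¹' {none} = (E ∪ R)ᶜ := by
    ext x
    simp only [Set.mem_preimage, Set.mem_singleton_iff, code_eq_none, Set.mem_compl_iff]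
  have h3 : ∀ k, Real.negMulLog (μ.real (code E R b g ⁻¹' {some (Sum.inr k)})) ≤
      2 * √(μ.real R) := fun k => by
    refine (negMulLog_le_two_mul_sqrt measureReal_nonneg).trans ?_
    gcongr
    · exact measure_ne_top _ _
    · intro x hx
      exact (code_eq_inr.1 hx).2.1
  have h4 : Real.negMulLog (μ.real (E ∪ R)ᶜ) ≤ μ.real E + μ.real R := by
    refine (negMulLog_le_one_sub measureReal_nonneg).trans ?_
    rw [probReal_compl_eq_one_sub (hE.union hR)]
    linarith [measureReal_union_le (μ := μ) E R]
  rw [ent, Fintype.sum_option, Fintype.sum_sum_type, h2]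
  simp only [h1]
  have h5 : ∑ k, Real.negMulLog (μ.real (code E R b g ⁻¹' {some (Sum.inr k)})) ≤
      Fintype.card κ * (2 * √(μ.real R)) := by
    simpa using Finset.sum_le_sum fun k (_ : k ∈ Finset.univ) => h3 k
  linarith

/-- Record `g` on the points that have a period in `[1, N]`. -/
noncomputable def periodicCode (T : X ≃ᵐ X) (N : ℕ) (g : X → κ) (x : X) : Option κ :=
  if x ∈ nonPeriodic T N then none else some (g x)

lemma fibresMeasurable_periodicCode [StandardBorelSpace X] (N : ℕ) {g : X → κ}
    (hg : FibresMeasurable g) : FibresMeasurable (periodicCode T N g) := by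
  refine ((FibresMeasurable.ofSet (measurableSet_nonPeriodic T N)).prodMk
    hg).of_factorsThrough fun x y hxy => ?_
  simp only [Prod.mk.injEq] at hxy
  simp only [periodicCode, hxy.1, hxy.2]

lemma iterate_factorial_eq {N : ℕ} {x : X} (hx : x ∉ nonPeriodic T N) :
    T^[N.factorial] x = x := by
  simp only [nonPeriodic, Set.mem_ofPred_eq, not_forall, not_not] at hx
  obtain ⟨i, hi, hiN, h⟩ := hx
  rw [orbit_natCast] at h
  exact Function.IsPeriodicPt.trans_dvd h (Nat.dvd_factorial hi hiN)

lemma periodicCode_iterate_mod (N : ℕ) (g : X → κ) (x : X) (k : ℕ) :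
    periodicCode T N g (T^[k % N.factorial] x) = periodicCode T N g (T^[k] x) := by
  have hper : Function.Periodic (fun k : ℕ => periodicCode T N g (T^[k] x)) N.factorial := by
    intro k
    by_cases h : T^[k] x ∈ nonPeriodic T N
    · have h' : T^[k + N.factorial] x ∈ nonPeriodic T N := by
        rw [add_comm, Function.iterate_add_apply, ← orbit_natCast T N.factorial,
          orbit_mem_nonPeriodic]
        exact h
      simp only [periodicCode, if_pos h, if_pos h']
    · simp only [add_comm k, Function.iterate_add_apply, iterate_factorial_eq h]
  exact hper.map_mod_nat k

lemma ent_block_le [StandardBorelSpace X] (hT : MeasurePreserving T μ μ) {n : ℕ} (N : ℕ)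
    {c : X → ι} (hc : FibresMeasurable c) {g : X → κ} (hg : FibresMeasurable g)
    {τ : Type*} [Fintype τ] {a : X → τ}
    (ha : Function.FactorsThrough a
      fun x => ((fun i : Fin n => c (orbit T (-(i : ℕ)) x)), periodicCode T N g x)) (m : ℕ) :
    ent μ (block T a m) ≤
      (m + n) * ent μ c + ent μ (block T (periodicCode T N g) N.factorial) := by
  have hp := (fibresMeasurable_periodicCode (T := T) N hg).block T.measurable N.factorial
  have hcm : ∀ l : Fin (m + n), FibresMeasurable fun x => c (orbit T ((l : ℕ) - n) x) :=
    fun l => hc.comp (measurable_orbit T _)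
  refine (ent_le_of_factorsThrough ((FibresMeasurable.pi hcm).prodMk hp) ?_).trans
    ((ent_prodMk_le (FibresMeasurable.pi hcm) hp).trans ?_)
  · intro x y hxy
    simp only [Prod.mk.injEq] at hxy
    funext k
    refine ha (Prod.ext (funext fun i => ?_) ?_)
    · have := congrFun hxy.1 ⟨k + n - i, by omega⟩
      simp only at this
      have e : ((k + n - i : ℕ) : ℤ) - n = -(i : ℕ) + (k : ℕ) := by
        have := i.2
        omega
      rw [e, ← orbit_orbit, ← orbit_orbit, orbit_natCast] at this
      exact this
    · have := congrFun hxy.2 ⟨k % N.factorial, Nat.mod_lt _ N.factorial_pos⟩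
      simp only [block, periodicCode_iterate_mod] at this
      exact this
  · gcongr
    refine (ent_pi_le hcm).trans (le_of_eq ?_)
    simp only [ent_comp hc (measurePreserving_orbit hT _), Finset.sum_const, Finset.card_univ,
      Fintype.card_fin, nsmul_eq_mul]
    push_cast
    ring

lemma hPart_le_of_factorsThrough [StandardBorelSpace X] (hT : MeasurePreserving T μ μ) {n : ℕ}
    (N : ℕ) {c : X → ι} (hc : FibresMeasurable c) {g : X → κ} (hg : FibresMeasurable g)
    {τ : Type*} [Fintype τ] {a : X → τ} (ham : FibresMeasurable a)
    (ha : Function.FactorsThrough a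
      fun x => ((fun i : Fin n => c (orbit T (-(i : ℕ)) x)), periodicCode T N g x)) :
    hPart μ T (fibrePartition a) ≤ ent μ c := by
  have hrep := represents_fibrePartition a
  set C := n * ent μ c + ent μ (block T (periodicCode T N g) N.factorial)
  have hlim : Tendsto (fun m : ℕ => ent μ c + C / m) atTop (𝓝 (ent μ c + 0)) :=
    tendsto_const_nhds.add (tendsto_const_div_atTop_nhds_zero_nat C)
  rw [add_zero] at hlim
  refine le_of_tendsto_of_tendsto (tendsto_hPart hT (hrep.isMPartition ham)) hlim ?_
  filter_upwards [eventually_gt_atTop 0] with m hm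
  have hm' : (0 : ℝ) < m := by exact_mod_cast hm
  rw [(hrep.joinN T m).entPart_eq, div_le_iff₀ hm', add_mul, div_mul_cancel₀ _ hm'.ne']
  have := ent_block_le hT N hc hg ha m
  simp only [C]
  linarith

/-- Copy labels along the tower over `E`, and use `g` elsewhere. -/
noncomputable def decode {n : ℕ} (lab : ι → ℕ → κ) (w : Fin n → Option (ι ⊕ κ)) (k : κ) : κ :=
  if h : ∃ i : Fin n, ∃ c, w i = some (Sum.inl c) then lab h.choose_spec.choose h.choose else k

lemma hPlusC_le_ent_code [StandardBorelSpace X] (hT : MeasurePreserving T μ μ) {n : ℕ}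
    (hn : 0 < n) (N : ℕ) {U : Finset (Set X)} {b : X → ι} (hb : FibresMeasurable b)
    {lab : ι → ℕ → U} (hlab : ∀ x, ∀ k < n, T^[k] x ∈ (lab (b x) k : Set X))
    {g : X → U} (hg : FibresMeasurable g) (hgU : ∀ x, x ∈ (g x : Set X))
    {E : Set X} (hE : MeasurableSet E) :
    hPlusC μ T U ≤ ent μ (code E (towerRest T n N E) b g) := by
  set R := towerRest T n N E
  have hR : MeasurableSet R := measurableSet_towerRest n N hE
  set c := code E R b g
  have hc : FibresMeasurable c := fibresMeasurable_code hE hR hb hg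
  set w : X → Fin n → Option (ι ⊕ U) := fun x i => c (orbit T (-(i : ℕ)) x)
  set a : X → U := fun x => decode lab (w x) (g x) with ha
  have haU : ∀ x, x ∈ (a x : Set X) := by
    intro x
    simp only [ha, decode]
    split_ifs with h
    · obtain ⟨-, hbi⟩ := code_eq_inl.1 h.choose_spec.choose_spec
      rw [← hbi]
      have := hlab (orbit T (-(h.choose : ℕ)) x) h.choose h.choose.2
      rwa [← orbit_natCast, orbit_orbit, add_neg_cancel, orbit_zero] at this
    · exact hgU x
  have hfac : Function.FactorsThrough a fun x => (w x, periodicCode T N g x) := by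
    intro x y hxy
    simp only [Prod.mk.injEq] at hxy
    obtain ⟨hw, hp⟩ := hxy
    by_cases h : ∃ i : Fin n, ∃ c, w x i = some (Sum.inl c)
    · simp only [ha, decode, ← hw, dif_pos h]
    · have h' := h
      rw [hw] at h'
      simp only [ha, decode, dif_neg h, dif_neg h']
      by_cases hx : x ∈ nonPeriodic T N
      · have hxE : ∀ i : ℕ, i < n → orbit T (-i) x ∉ E := fun i hi hiE =>
          h ⟨⟨i, hi⟩, _, code_eq_inl.2 ⟨hiE, rfl⟩⟩
        have hx0 : c x = some (Sum.inr (g x)) :=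
          code_eq_inr.2 ⟨by simpa using hxE 0 hn, ⟨hx, hxE⟩, rfl⟩
        have hxy0 : c x = c y := by simpa [w] using congrFun hw ⟨0, hn⟩
        exact (code_eq_inr.1 (hxy0 ▸ hx0)).2.2.symm
      · simp only [periodicCode, if_neg hx] at hp
        split_ifs at hp
        exact Option.some_inj.1 hp
  have ham : FibresMeasurable a :=
    ((FibresMeasurable.pi fun i : Fin n => hc.comp (measurable_orbit T (-(i : ℕ)))).prodMk
      (fibresMeasurable_periodicCode N hg)).of_factorsThrough hfac
  refine (hPlusC_le hT ((represents_fibrePartition a).isMPartition ham) fun A hA => ?_).trans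
    (hPart_le_of_factorsThrough hT N hc hg ham hfac)
  obtain ⟨u, -, rfl⟩ := Finset.mem_image.1 hA
  refine ⟨u, u.2, fun x hx => ?_⟩
  rw [← show a x = u from hx]
  exact haU x

lemma hPlusC_le_entPart_div [StandardBorelSpace X] (hT : MeasurePreserving T μ μ)
    {U : Finset (Set X)} (hU : IsMCover U) {n : ℕ} (hn : 0 < n) {β : Finset (Set X)}
    (hβ : IsMPartition β) (hβU : Refines β (joinN T U n)) :
    hPlusC μ T U ≤ entPart μ β / n + (2 * √(1 / n) + U.card * (2 * (1 / n)) +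
      (1 / n + (1 / n) ^ 2)) := by
  obtain ⟨b, hb, hβb, hbmem⟩ := hβ.exists_represents
  obtain ⟨g, hg, hgU⟩ := hU.exists_selector
  have hlab : ∀ A : β, ∀ k : ℕ, ∃ u : U, k < n → ∀ x ∈ (A : Set X), T^[k] x ∈ (u : Set X) := by
    intro A k
    by_cases hk : k < n
    · obtain ⟨C, hC, h⟩ := refines_joinN.1 hβU A A.2 k hk
      exact ⟨⟨C, hC⟩, fun _ => h⟩
    · have : Nonempty X := nonempty_of_isProbabilityMeasure μ
      exact ⟨g this.some, fun h => absurd h hk⟩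
  choose lab hlab using hlab
  obtain ⟨E, hE, hER, hE1, hEent⟩ := exists_tower_ent_le hT hn (n ^ 4) hb
  have hR := measurableSet_towerRest (T := T) n (n ^ 4) hE
  have hn' : (0 : ℝ) < n := by exact_mod_cast hn
  have hR1 : μ.real (towerRest T n (n ^ 4) E) ≤ (1 / n) ^ 2 := by
    refine hER.trans ?_
    rw [div_pow, div_le_div_iff₀ (by positivity) (by positivity)]
    push_cast
    nlinarith
  have hR2 : √(μ.real (towerRest T n (n ^ 4) E)) ≤ 1 / n :=
    Real.sqrt_le_iff.2 ⟨by positivity, hR1⟩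
  have hE2 : Real.negMulLog (μ.real E) ≤ 2 * √(1 / n) :=
    (negMulLog_le_two_mul_sqrt measureReal_nonneg).trans
      (mul_le_mul_of_nonneg_left (Real.sqrt_le_sqrt hE1) zero_le_two)
  have h1 := hPlusC_le_ent_code hT hn (n ^ 4) hb
    (fun x k hk => hlab (b x) k hk x (hbmem x)) hg hgU hE
  have h2 := ent_code_le (μ := μ) hE hR b g
  have h3 : (U.card : ℝ) * (2 * √(μ.real (towerRest T n (n ^ 4) E))) ≤
      U.card * (2 * (1 / n)) := by gcongr
  rw [Fintype.card_coe] at h2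
  rw [hβb.entPart_eq]
  linarith

lemma hPlusC_le_hMinusC [StandardBorelSpace X] (hT : MeasurePreserving T μ μ)
    {U : Finset (Set X)} (hU : IsMCover U) : hPlusC μ T U ≤ hMinusC μ T U := by
  have h0 : Tendsto (fun n : ℕ => (1 : ℝ) / n) atTop (𝓝 0) :=
    tendsto_const_div_atTop_nhds_zero_nat 1
  have hδ : Tendsto (fun n : ℕ => 2 * √((1 : ℝ) / n) + U.card * (2 * (1 / n)) +
      (1 / n + (1 / n) ^ 2)) atTop
      (𝓝 (2 * √0 + U.card * (2 * 0) + (0 + 0 ^ 2))) :=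
    ((((Real.continuous_sqrt.tendsto 0).comp h0).const_mul 2).add
      ((h0.const_mul 2).const_mul _)).add (h0.add (h0.pow 2))
  have hlim := (tendsto_hMinusC hT hU).add hδ
  simp only [Real.sqrt_zero, mul_zero, ne_eq, OfNat.ofNat_ne_zero, not_false_eq_true, zero_pow,
    add_zero] at hlim
  refine ge_of_tendsto hlim ?_
  filter_upwards [eventually_gt_atTop 0] with n hn
  have hn' : (0 : ℝ) < n := by exact_mod_cast hn
  rw [← sub_le_iff_le_add, le_div_iff₀ hn']
  refine hU.le_entCover_joinN T.measurable fun β hβ hβU => ?_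
  rw [← le_div_iff₀ hn', sub_le_iff_le_add]
  exact hPlusC_le_entPart_div hT hU hn hβ hβU

end Coding

/-- For an arbitrary (not necessarily ergodic) m.t.d.s.
`(X, 𝓑, μ, T)` and a cover `𝓤`, `h_μ⁺(𝓤, T) = h_μ⁻(𝓤, T)`. -/
theorem hPlus_eq_hMinus {X : Type*} [MeasurableSpace X] [StandardBorelSpace X]
    (μ : Measure X) [IsProbabilityMeasure μ] (T : X ≃ᵐ X)
    (hT : MeasurePreserving ⇑T μ μ)
    (U : Finset (Set X)) (hU : IsMCover U) :
    hPlusC μ ⇑T U = hMinusC μ ⇑T U :=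
  le_antisymm (hPlusC_le_hMinusC hT hU) (hMinusC_le_hPlusC hT hU)
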